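/- arXiv:1511.00583 — 4 statements merged into one kernel-verified Lean document; each statement's English description precedes it below -/
import Mathlib

section
/- There exists m₀ with the following property. Let m ≥ m₀ and 4 ≤ t ≤ m − 4, let N = C(m, t), and let v_1, …, v_N ∈ {0,1}^m be an enumeration of the indicator vectors of all t-element subsets of {1, …, m}. Then for any b_1, …, b_N ∈ {0, 1} there exist integers c_1, …, c_N such that (i) c_i ≡ b_i (mod 2) for all i, (ii) ‖Σ_{i=1}^N c_i·v_i‖_∞ ≤ 2, and (iii) |c_i| ≤ 7 for all i. -/
open Finset

section SignedSums

variable {ι κ : Type*} [Fintype ι] [Fintype κ]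

/-- A point of the cube `[-1, 1]^ι` at which `∑ x s • v s` vanishes and which has at most
`card κ` coordinates in the open interval `(-1, 1)`. -/
theorem exists_sum_eq_zero_card_abs_ne_one_le (v : ι → κ → ℝ) :
    ∃ x : ι → ℝ, (∀ s, |x s| ≤ 1) ∧ (∀ k, ∑ s, x s * v s k = 0) ∧
      (univ.filter fun s => |x s| ≠ 1).card ≤ Fintype.card κ := by
  classical
  have hcompact : IsCompact {x : ι → ℝ | (∀ s, |x s| ≤ 1) ∧ ∀ k, ∑ s, x s * v s k = 0} := by
    refine IsCompact.of_isClosed_subset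
      (isCompact_univ_pi fun _ : ι => isCompact_Icc (a := (-1 : ℝ)) (b := 1)) ?_ ?_
    · simp only [Set.ofPred_and, Set.ofPred_forall]
      refine IsClosed.inter (isClosed_iInter fun s => ?_) (isClosed_iInter fun k => ?_)
      · exact isClosed_le (by fun_prop) continuous_const
      · exact isClosed_eq (by fun_prop) continuous_const
    · exact fun x hx s _ => abs_le.mp (hx.1 s)
  obtain ⟨x, ⟨hx1, hx0⟩, hmax⟩ := hcompact.exists_isMaxOn ⟨0, by simp⟩
    (f := fun x : ι → ℝ => ∑ s, x s ^ 2) (by fun_prop)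
  refine ⟨x, hx1, hx0, ?_⟩
  by_contra! hcard
  let T := {s : ι // |x s| = 1}
  let L : (ι → ℝ) →ₗ[ℝ] (κ → ℝ) × (T → ℝ) :=
    { toFun := fun y => (fun k => ∑ s, y s * v s k, fun s => y s)
      map_add' := fun y z => by
        ext <;> simp [add_mul, sum_add_distrib]
      map_smul' := fun r y => by
        ext <;> simp [mul_sum, mul_assoc] }
  have hker : LinearMap.ker L ≠ ⊥ := by
    apply LinearMap.ker_ne_bot_of_finrank_lt
    have hT : Fintype.card T = (univ.filter fun s => |x s| = 1).card := Fintype.card_subtype _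
    have := card_filter_add_card_filter_not (s := (univ : Finset ι)) (fun s => |x s| = 1)
    simp only [Module.finrank_prod, Module.finrank_fintype_fun_eq_card, hT]
    rw [card_univ] at this
    simp only [ne_eq] at hcard
    omega
  obtain ⟨y, hy, hy0⟩ := (Submodule.ne_bot_iff _).mp hker
  rw [LinearMap.mem_ker, Prod.ext_iff] at hy
  have hyv : ∀ k, ∑ s, y s * v s k = 0 := fun k => congrFun hy.1 k
  have hyT : ∀ s, |x s| = 1 → y s = 0 := fun s hs => congrFun hy.2 ⟨s, hs⟩
  have hsmall : ∀ σ : ℝ, ∀ᶠ ε : ℝ in nhds 0, ∀ s, |x s + σ * ε * y s| ≤ 1 := by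
    intro σ
    rw [Filter.eventually_all]
    intro s
    rcases eq_or_ne |x s| 1 with h | h
    · simp [hyT s h, h]
    · have hlt : |x s + σ * 0 * y s| < 1 := by simpa using lt_of_le_of_ne (hx1 s) h
      have hcont : Continuous fun ε : ℝ => |x s + σ * ε * y s| := by fun_prop
      exact (hcont.continuousAt.eventually (gt_mem_nhds hlt)).mono fun _ h => le_of_lt h
  obtain ⟨ε, ⟨hp, hn⟩, hε⟩ := ((((hsmall 1).and (hsmall (-1))).filter_mono
    (nhdsWithin_le_nhds (s := {0}ᶜ))).and self_mem_nhdsWithin).exists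
  have hle : ∀ σ : ℝ, (∀ s, |x s + σ * ε * y s| ≤ 1) →
      ∑ s, (x s + σ * ε * y s) ^ 2 ≤ ∑ s, x s ^ 2 := by
    intro σ hσ
    refine hmax (a := fun s => x s + σ * ε * y s) ⟨hσ, fun k => ?_⟩
    simp only [add_mul, sum_add_distrib, hx0, mul_assoc, ← mul_sum, hyv, mul_zero, add_zero]
  have hsum := add_le_add (hle 1 hp) (hle (-1) hn)
  have hexp : ∑ s, (x s + 1 * ε * y s) ^ 2 + ∑ s, (x s + -1 * ε * y s) ^ 2
      = ∑ s, x s ^ 2 + ∑ s, x s ^ 2 + 2 * ε ^ 2 * ∑ s, y s ^ 2 := by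
    simp only [mul_sum, ← sum_add_distrib]
    exact sum_congr rfl fun s _ => by ring
  obtain ⟨s, hs⟩ := Function.ne_iff.mp hy0
  have hpos : 0 < ∑ s, y s ^ 2 :=
    sum_pos' (fun _ _ => sq_nonneg _) ⟨s, mem_univ s, sq_pos_of_ne_zero hs⟩
  have : 0 < 2 * ε ^ 2 * ∑ s, y s ^ 2 := by
    have : 0 < ε ^ 2 := by have : ε ≠ 0 := hε; positivity
    positivity
  linarith

/-- The function `|∑ x s • v s|² + ∑ (1 - x s ^ 2) |v s|²`, which is affine in each `x s`. -/
noncomputable def multiaffineEnergy (v : ι → κ → ℝ) (x : ι → ℝ) : ℝ :=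
  ∑ k, ((∑ s, x s * v s k) ^ 2 + ∑ s, (1 - x s ^ 2) * v s k ^ 2)

theorem multiaffineEnergy_update [DecidableEq ι] (v : ι → κ → ℝ) (x : ι → ℝ) (s : ι) :
    (1 + x s) * multiaffineEnergy v (Function.update x s 1) +
      (1 - x s) * multiaffineEnergy v (Function.update x s (-1)) =
      2 * multiaffineEnergy v x := by
  simp only [multiaffineEnergy, mul_sum, ← sum_add_distrib]
  refine sum_congr rfl fun k _ => ?_
  have hlin : ∀ z, ∑ r, Function.update x s z r * v r k
      = z * v s k + ∑ r ∈ univ.erase s, x r * v r k := by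
    intro z
    rw [← add_sum_erase _ _ (mem_univ s), Function.update_self]
    congr 1
    exact sum_congr rfl fun r hr => by rw [Function.update_of_ne (ne_of_mem_erase hr)]
  have hsq : ∀ z, ∑ r, (1 - Function.update x s z r ^ 2) * v r k ^ 2
      = (1 - z ^ 2) * v s k ^ 2 + ∑ r ∈ univ.erase s, (1 - x r ^ 2) * v r k ^ 2 := by
    intro z
    rw [← add_sum_erase _ _ (mem_univ s), Function.update_self]
    congr 1
    exact sum_congr rfl fun r hr => by rw [Function.update_of_ne (ne_of_mem_erase hr)]
  have hlin' := hlin (x s)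
  have hsq' := hsq (x s)
  rw [Function.update_eq_self] at hlin' hsq'
  rw [hlin, hlin, hsq, hsq, hlin', hsq']
  ring

theorem exists_sign_multiaffineEnergy_le (v : ι → κ → ℝ) (x : ι → ℝ) (hx : ∀ s, |x s| ≤ 1) :
    ∃ y : ι → ℝ, (∀ s, y s = 1 ∨ y s = -1) ∧ multiaffineEnergy v y ≤ multiaffineEnergy v x := by
  classical
  suffices h : ∀ T : Finset ι, ∃ y : ι → ℝ, (∀ s, |y s| ≤ 1) ∧ (∀ s ∈ T, y s = 1 ∨ y s = -1) ∧
      multiaffineEnergy v y ≤ multiaffineEnergy v x by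
    obtain ⟨y, -, hy, hle⟩ := h univ
    exact ⟨y, fun s => hy s (mem_univ s), hle⟩
  intro T
  induction T using Finset.induction_on with
  | empty => exact ⟨x, hx, by simp, le_rfl⟩
  | insert a T _ ih =>
    obtain ⟨y, hy, hyT, hle⟩ := ih
    obtain ⟨z, hz, hzle⟩ : ∃ z : ℝ, (z = 1 ∨ z = -1) ∧
        multiaffineEnergy v (Function.update y a z) ≤ multiaffineEnergy v y := by
      by_contra! hcon
      have h1 := hcon 1 (Or.inl rfl)
      have h2 := hcon (-1) (Or.inr rfl)
      have h3 := multiaffineEnergy_update v y a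
      have h4 := abs_le.mp (hy a)
      rcases h4.1.eq_or_lt with h | h
      · rw [← h] at h3; linarith
      · nlinarith
    refine ⟨Function.update y a z, fun s => ?_, fun s hs => ?_, hzle.trans hle⟩
    · rcases eq_or_ne s a with rfl | h
      · rcases hz with rfl | rfl <;> simp
      · simpa [h] using hy s
    · rcases eq_or_ne s a with rfl | h
      · simpa using hz
      · simpa [h] using hyT s (mem_of_mem_insert_of_ne hs h)

/-- Vectors `v s` of squared Euclidean norm at most `M` have a signed sum of squared Euclidean norm
at most `M` times the dimension. -/
theorem exists_sign_sum_sq_le (v : ι → κ → ℤ) (M : ℕ) (hv : ∀ s, ∑ k, v s k ^ 2 ≤ M) :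
    ∃ ε : ι → ℤ, (∀ s, ε s = 1 ∨ ε s = -1) ∧
      ∑ k, (∑ s, ε s * v s k) ^ 2 ≤ Fintype.card κ * M := by
  classical
  obtain ⟨x, hx1, hx0, hcard⟩ :=
    exists_sum_eq_zero_card_abs_ne_one_le (fun s k => (v s k : ℝ))
  obtain ⟨y, hy, hle⟩ := exists_sign_multiaffineEnergy_le (fun s k => (v s k : ℝ)) x hx1
  have hyint : ∀ s, ∃ e : ℤ, (e = 1 ∨ e = -1) ∧ (e : ℝ) = y s := by
    intro s
    rcases hy s with h | h
    · exact ⟨1, by simp, by simp [h]⟩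
    · exact ⟨-1, by simp, by simp [h]⟩
  choose ε hε hεy using hyint
  refine ⟨ε, hε, ?_⟩
  have hEy : multiaffineEnergy (fun s k => (v s k : ℝ)) y
      = ∑ k, (∑ s, (ε s : ℝ) * v s k) ^ 2 := by
    have : ∀ s, y s ^ 2 = 1 := fun s => by rcases hy s with h | h <;> simp [h]
    simp [multiaffineEnergy, hεy, this]
  have hEx : multiaffineEnergy (fun s k => (v s k : ℝ)) x ≤ Fintype.card κ * M := by
    simp only [multiaffineEnergy, hx0]
    simp only [ne_eq, OfNat.ofNat_ne_zero, not_false_eq_true, zero_pow, zero_add]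
    rw [sum_comm]
    calc ∑ s, ∑ k, (1 - x s ^ 2) * (v s k : ℝ) ^ 2
        ≤ ∑ s, (if |x s| ≠ 1 then (M : ℝ) else 0) := by
          refine sum_le_sum fun s _ => ?_
          rw [← mul_sum]
          have hs : ∑ k, (v s k : ℝ) ^ 2 ≤ M := by exact_mod_cast hv s
          have hs0 : 0 ≤ ∑ k, (v s k : ℝ) ^ 2 := sum_nonneg fun _ _ => sq_nonneg _
          split_ifs with h
          · nlinarith [sq_nonneg (x s)]
          · rw [not_not] at h
            rw [← sq_abs, h]
            simp
      _ = (univ.filter fun s => |x s| ≠ 1).card * (M : ℝ) := by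
          rw [← sum_filter, sum_const, nsmul_eq_mul]
      _ ≤ Fintype.card κ * M := by gcongr
  exact_mod_cast hEy ▸ hle.trans hEx

end SignedSums

section Load

variable {m : ℕ}

/-- The coordinates of `∑ c S • 1_S`, the sum running over the `t`-element sets `S`. -/
def subsetLoad (t : ℕ) (c : Finset (Fin m) → ℤ) (j : Fin m) : ℤ :=
  ∑ S ∈ univ.filter (fun S : Finset (Fin m) => S.card = t), c S * (if j ∈ S then 1 else 0)

/-- Twice the squared norm of the load, plus the `ℓ¹` distance to `a`. -/
def loadCost (t : ℕ) (a c : Finset (Fin m) → ℤ) : ℤ :=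
  2 * ∑ j, subsetLoad t c j ^ 2 + ∑ S, |c S - a S|

/-- Coefficients of the parities `b` and absolute value at most `7`. -/
def IsAdmissible (b c : Finset (Fin m) → ℤ) : Prop :=
  ∀ S, (2 : ℤ) ∣ c S - b S ∧ |c S| ≤ 7

theorem subsetLoad_add_single (c : Finset (Fin m) → ℤ) (S : Finset (Fin m)) (z : ℤ) (j : Fin m) :
    subsetLoad S.card (c + Pi.single S z) j
      = subsetLoad S.card c j + z * (if j ∈ S then 1 else 0) := by
  simp only [subsetLoad, Pi.add_apply, add_mul, sum_add_distrib]
  congr 1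
  rw [sum_eq_single_of_mem S (by simp)]
  · simp
  · intro T _ hT
    simp [Pi.single_eq_of_ne hT]

theorem sum_abs_add_single_sub_le (a c : Finset (Fin m) → ℤ) (S : Finset (Fin m)) (z : ℤ) :
    ∑ T, |(c + Pi.single S z : Finset (Fin m) → ℤ) T - a T| ≤ ∑ T, |c T - a T| + |z| := by
  calc ∑ T, |(c + Pi.single S z : Finset (Fin m) → ℤ) T - a T|
      ≤ ∑ T, (|c T - a T| + |(Pi.single S z : Finset (Fin m) → ℤ) T|) := by
        refine sum_le_sum fun T _ => ?_
        rw [Pi.add_apply, add_sub_right_comm]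
        exact abs_add_le _ _
    _ = ∑ T, |c T - a T| + |z| := by
        rw [sum_add_distrib]
        congr 1
        rw [sum_eq_single_of_mem S (mem_univ S)]
        · simp
        · intro T _ hT
          simp [Pi.single_eq_of_ne hT]

theorem IsAdmissible.add_single {b c : Finset (Fin m) → ℤ} (hc : IsAdmissible b c)
    {S : Finset (Fin m)} (hS : |c S| ≤ 5) {z : ℤ} (hz2 : 2 ∣ z) (hz : |z| ≤ 2) :
    IsAdmissible b (c + Pi.single S z) := by
  intro T
  rcases eq_or_ne T S with rfl | h
  · have h1 := (hc T).1
    have h2 := abs_add_le (c T) z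
    simp only [Pi.add_apply, Pi.single_eq_same]
    exact ⟨by omega, by omega⟩
  · simpa [Pi.single_eq_of_ne h] using hc T

variable {t : ℕ} {a b c : Finset (Fin m) → ℤ}

theorem abs_sum_subsetLoad_le (hc : IsAdmissible b c)
    (hmin : ∀ c', IsAdmissible b c' → loadCost t a c ≤ loadCost t a c')
    {S : Finset (Fin m)} (hSt : S.card = t) (hS : |c S| ≤ 5) :
    |∑ j ∈ S, subsetLoad t c j| ≤ t := by
  subst hSt
  have key : ∀ z : ℤ, 2 ∣ z → |z| = 2 → 0 ≤ 2 * z * ∑ j ∈ S, subsetLoad S.card c j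
      + 4 * S.card + 1 := by
    intro z hz2 hz
    have h1 := hmin _ (hc.add_single hS hz2 hz.le)
    have h2 := sum_abs_add_single_sub_le a c S z
    have h3 : ∑ j, subsetLoad S.card (c + Pi.single S z) j ^ 2
        = ∑ j, subsetLoad S.card c j ^ 2 + 2 * z * ∑ j ∈ S, subsetLoad S.card c j
          + z ^ 2 * S.card := by
      have : ∀ j, subsetLoad S.card (c + Pi.single S z) j ^ 2 = subsetLoad S.card c j ^ 2
          + 2 * z * (if j ∈ S then subsetLoad S.card c j else 0)
          + z ^ 2 * (if j ∈ S then 1 else 0) := by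
        intro j
        rw [subsetLoad_add_single]
        split_ifs <;> ring
      simp only [this, sum_add_distrib, ← mul_sum]
      simp
    have h4 : z ^ 2 = 4 := by rw [← sq_abs, hz]; norm_num
    rw [h4] at h3
    simp only [loadCost, h3] at h1
    omega
  have hp := key 2 (by norm_num) (by norm_num)
  have hn := key (-2) (by norm_num) (by norm_num)
  rw [abs_le]
  constructor <;> omega

theorem subsetLoad_sub_le (hc : IsAdmissible b c)
    (hmin : ∀ c', IsAdmissible b c' → loadCost t a c ≤ loadCost t a c')
    {R : Finset (Fin m)} {i j : Fin m} (hij : i ≠ j) (hiR : i ∉ R) (hjR : j ∉ R)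
    (hR : R.card + 1 = t) (hi : |c (insert i R)| ≤ 5) (hj : |c (insert j R)| ≤ 5) :
    subsetLoad t c i - subsetLoad t c j ≤ 2 := by
  have hti : (insert i R).card = t := by rw [card_insert_of_notMem hiR, hR]
  have htj : (insert j R).card = t := by rw [card_insert_of_notMem hjR, hR]
  have hne : insert j R ≠ insert i R := fun h => by
    have : j ∈ insert i R := h ▸ mem_insert_self j R
    rcases mem_insert.mp this with h | h
    · exact hij h.symm
    · exact hjR h
  set c₁ := c + Pi.single (insert i R) (-2) with hc₁
  have had₁ : IsAdmissible b c₁ := hc.add_single hi (by norm_num) (by norm_num)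
  have hval : c₁ (insert j R) = c (insert j R) := by simp [hc₁, Pi.single_eq_of_ne hne]
  have had₂ : IsAdmissible b (c₁ + Pi.single (insert j R) 2) :=
    had₁.add_single (by rwa [hval]) (by norm_num) (by norm_num)
  have h1 := hmin _ had₂
  have h2 := sum_abs_add_single_sub_le a c₁ (insert j R) 2
  have h2' := sum_abs_add_single_sub_le a c (insert i R) (-2)
  have h3 : ∑ k, subsetLoad t (c₁ + Pi.single (insert j R) 2) k ^ 2
      = ∑ k, subsetLoad t c k ^ 2 - 4 * subsetLoad t c i + 4 * subsetLoad t c j + 8 := by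
    have hload : ∀ k, subsetLoad t (c₁ + Pi.single (insert j R) 2) k ^ 2 = subsetLoad t c k ^ 2
        + (if k = i then -4 * subsetLoad t c i + 4 else 0)
        + (if k = j then 4 * subsetLoad t c j + 4 else 0) := by
      intro k
      have e1 := subsetLoad_add_single c₁ (insert j R) 2 k
      have e2 := subsetLoad_add_single c (insert i R) (-2) k
      rw [htj] at e1
      rw [hti] at e2
      rw [e1, hc₁, e2]
      rcases eq_or_ne k i with rfl | hki
      · simp only [mem_insert, true_or, if_true, hij, hiR, or_self, if_false]
        ring
      · rcases eq_or_ne k j with rfl | hkj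
        · simp only [mem_insert, true_or, if_true, hki, hjR, or_self, if_false]
          ring
        · simp only [mem_insert, hki, hkj, false_or, if_false]
          ring
    simp only [hload, sum_add_distrib, sum_ite_eq', mem_univ, if_true]
    ring
  simp only [loadCost, h3] at h1
  rw [← hc₁, abs_neg] at h2'
  rw [abs_two] at h2 h2'
  linarith

end Load

theorem choose_three_le_choose {n k : ℕ} (hk : 3 ≤ k) (hkn : k + 3 ≤ n) :
    n.choose 3 ≤ n.choose k := by
  induction n generalizing k with
  | zero => omega
  | succ n ih =>
    obtain rfl | h3 := hk.eq_or_lt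
    · rfl
    obtain h | h := hkn.eq_or_lt
    · rw [← h, Nat.choose_symm_add]
    · obtain ⟨k, rfl⟩ : ∃ l, k = l + 1 := ⟨k - 1, by omega⟩
      rw [Nat.choose_succ_succ' n 2, Nat.choose_succ_succ' n k]
      exact add_le_add
        ((Nat.choose_le_succ_of_lt_half_left (by omega)).trans (ih (by omega) (by omega)))
        (ih (by omega) (by omega))

theorem sq_lt_choose_three {n : ℕ} (hn : 18 ≤ n) : (n + 2) ^ 2 < n.choose 3 := by
  suffices h : 2 * n + 5 ≤ n.choose 2 ∧ (n + 2) ^ 2 < n.choose 3 from h.2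
  induction n, hn using Nat.le_induction with
  | base => decide
  | succ n _ ih =>
    have h2 : (n + 1).choose 2 = n.choose 1 + n.choose 2 := Nat.choose_succ_succ n 1
    have h3 : (n + 1).choose 3 = n.choose 2 + n.choose 3 := Nat.choose_succ_succ n 2
    rw [h2, h3, Nat.choose_one_right]
    constructor
    · omega
    · nlinarith [ih.1, ih.2]

/-- A family of fewer than `C(m - 2, r)` sets misses both `insert i R` and `insert j R` for some
`r`-element set `R` avoiding `i` and `j`. -/
theorem exists_insert_notMem {m r : ℕ} (F : Finset (Finset (Fin m)))
    (hF : F.card < (m - 2).choose r) {i j : Fin m} (hij : i ≠ j) :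
    ∃ R : Finset (Fin m), i ∉ R ∧ j ∉ R ∧ R.card = r ∧ insert i R ∉ F ∧ insert j R ∉ F := by
  by_contra! hcon
  have hsub : powersetCard r (univ \ {i, j}) ⊆ F.image fun S => S \ {i, j} := by
    intro R hR
    obtain ⟨hR, hcard⟩ := mem_powersetCard.mp hR
    have hi : i ∉ R := fun h => by simpa using hR h
    have hj : j ∉ R := fun h => by simpa using hR h
    rw [mem_image]
    have hdiff : R \ {i, j} = R := by
      rw [Finset.sdiff_eq_self_iff_disjoint]
      simp [hi, hj]
    by_cases h : insert i R ∈ F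
    · exact ⟨_, h, by rw [insert_sdiff_of_mem _ (by simp), hdiff]⟩
    · exact ⟨_, hcon R hi hj hcard h, by rw [insert_sdiff_of_mem _ (by simp), hdiff]⟩
  have hle := (card_le_card hsub).trans card_image_le
  rw [card_powersetCard, card_sdiff_of_subset (subset_univ _), card_univ, Fintype.card_fin,
    card_pair hij] at hle
  omega

/-- For `m` large enough and `4 ≤ t ≤ m - 4`, indexing the indicator vectors of the
`t`-element subsets `S ⊆ [m]` by the subsets themselves: for any choice of parities
`b_S ∈ {0,1}` there exist integers `c_S` with `c_S ≡ b_S (mod 2)`, `|c_S| ≤ 7`, and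
`‖Σ_S c_S 1_S‖_∞ ≤ 2`. -/
theorem parity_correction :
    ∃ m₀ : ℕ, ∀ m t : ℕ, m₀ ≤ m → 4 ≤ t → t + 4 ≤ m →
      ∀ b : Finset (Fin m) → ℤ, (∀ S, b S = 0 ∨ b S = 1) →
      ∃ c : Finset (Fin m) → ℤ,
        (∀ S : Finset (Fin m), S.card = t → (2 : ℤ) ∣ (c S - b S) ∧ |c S| ≤ 7) ∧
        (∀ j : Fin m,
          |∑ S ∈ Finset.univ.filter (fun S : Finset (Fin m) => S.card = t),
              c S * (if j ∈ S then 1 else 0)| ≤ 2) := by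
  refine ⟨20, fun m t hm ht htm b hb => ?_⟩
  obtain ⟨ε, hε, hnorm⟩ := exists_sign_sum_sq_le
    (fun (S : Finset (Fin m)) (j : Fin m) =>
      if S.card = t then b S * (if j ∈ S then 1 else 0) else 0) t (by
    intro S
    split_ifs with h
    · rcases hb S with h0 | h0 <;> simp [h0, h]
    · simp)
  set a : Finset (Fin m) → ℤ := fun S => ε S * b S with ha
  have ha1 : ∀ S, |a S| ≤ 1 := by
    intro S
    rcases hε S with h | h <;> rcases hb S with h' | h' <;> simp [ha, h, h']
  have haad : IsAdmissible b a := by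
    intro S
    refine ⟨?_, (ha1 S).trans (by norm_num)⟩
    rcases hε S with h | h <;> rcases hb S with h' | h' <;> simp [ha, h, h']
  have hacost : loadCost t a a ≤ 2 * (m * t) := by
    have : ∀ j, subsetLoad t a j = ∑ S, ε S *
        (if S.card = t then b S * (if j ∈ S then 1 else 0) else 0) := by
      intro j
      simp only [subsetLoad, sum_filter, ha]
      exact sum_congr rfl fun S _ => by split_ifs <;> ring
    simpa [loadCost, this] using hnorm
  have hcost0 : ∀ c, 0 ≤ loadCost t a c := fun c => by
    have := sum_nonneg fun (j : Fin m) (_ : j ∈ univ) => sq_nonneg (subsetLoad t c j)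
    have := sum_nonneg fun (S : Finset (Fin m)) (_ : S ∈ univ) => abs_nonneg (c S - a S)
    simp only [loadCost]
    linarith
  obtain ⟨c, hc, hmin⟩ : ∃ c, IsAdmissible b c ∧
      ∀ c', IsAdmissible b c' → loadCost t a c ≤ loadCost t a c' := by
    obtain ⟨c, hc, hmin⟩ := exists_minimalFor_of_wellFoundedLT (IsAdmissible b)
      (fun c => (loadCost t a c).toNat) ⟨a, haad⟩
    refine ⟨c, hc, fun c' hc' => ?_⟩
    by_contra! hlt
    have := hcost0 c
    have := hcost0 c'
    have := hmin hc' (by simp only; omega)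
    simp only at this
    omega
  refine ⟨c, fun S _ => hc S, ?_⟩
  change ∀ j, |subsetLoad t c j| ≤ 2
  set F := univ.filter fun S => 5 < |c S| with hF
  have hFcard : F.card < (m - 2).choose (t - 1) := by
    have h1 : (F.card : ℤ) * 5 ≤ ∑ S, |c S - a S| := by
      calc (F.card : ℤ) * 5 = ∑ S ∈ F, 5 := by simp
        _ ≤ ∑ S ∈ F, |c S - a S| := by
          refine sum_le_sum fun S hS => ?_
          have h5 : 5 < |c S| := (mem_filter.mp hS).2
          have := abs_sub_abs_le_abs_sub (c S) (a S)
          have := ha1 S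
          omega
        _ ≤ ∑ S, |c S - a S| := sum_le_univ_sum_of_nonneg fun _ => abs_nonneg _
    have h2 : ∑ S, |c S - a S| ≤ loadCost t a c := by
      have := sum_nonneg fun (j : Fin m) (_ : j ∈ univ) => sq_nonneg (subsetLoad t c j)
      simp only [loadCost]
      linarith
    have h3 : (F.card : ℤ) * 5 ≤ 2 * (m * t) := h1.trans (h2.trans ((hmin a haad).trans hacost))
    have h4 : F.card * 5 ≤ 2 * (m * t) := by exact_mod_cast h3
    have h5 : (m - 2 + 2) ^ 2 < (m - 2).choose 3 := sq_lt_choose_three (by omega)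
    have h6 : (m - 2).choose 3 ≤ (m - 2).choose (t - 1) :=
      choose_three_le_choose (by omega) (by omega)
    rw [show m - 2 + 2 = m by omega] at h5
    nlinarith
  have hdiff : ∀ i j, subsetLoad t c i - subsetLoad t c j ≤ 2 := by
    intro i j
    rcases eq_or_ne i j with rfl | hij
    · simp
    obtain ⟨R, hi, hj, hR, hiF, hjF⟩ := exists_insert_notMem F hFcard hij
    simp only [hF, mem_filter, mem_univ, true_and, not_lt] at hiF hjF
    exact subsetLoad_sub_le hc hmin hij hi hj (by omega) hiF hjF
  intro i
  have : Nontrivial (Fin m) := Fin.nontrivial_iff_two_le.mpr (by omega)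
  obtain ⟨j, hj⟩ := exists_ne i
  obtain ⟨R, hiR, -, hR, hiF, -⟩ := exists_insert_notMem F hFcard hj.symm
  simp only [hF, mem_filter, mem_univ, true_and, not_lt] at hiF
  have hsum := abs_sum_subsetLoad_le hc hmin
    (by rw [card_insert_of_notMem hiR]; omega) hiF
  rw [sum_insert hiR, abs_le] at hsum
  have hRt : (R.card : ℤ) = t - 1 := by omega
  rw [abs_le]
  constructor
  · by_contra! h
    have : ∑ k ∈ R, subsetLoad t c k ≤ ∑ k ∈ R, (-1) :=
      sum_le_sum fun k _ => by have := hdiff k i; omega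
    simp only [sum_const, nsmul_eq_mul, hRt] at this
    omega
  · by_contra! h
    have : ∑ k ∈ R, 1 ≤ ∑ k ∈ R, subsetLoad t c k :=
      sum_le_sum fun k _ => by have := hdiff i k; omega
    simp only [sum_const, nsmul_eq_mul, hRt] at this
    omega
end

section
/- Let 1 ≤ t ≤ m − 1. The subgroup of ℤ^m generated (over ℤ) by the indicator vectors of all t-element subsets of {1, …, m} equals the lattice ℒ = {x ∈ ℤ^m : Σ_{i=1}^m x_i ≡ 0 (mod t)}. -/
open Finset

/-- The difference of two standard basis vectors lies in the subgroup generated by the indicator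
vectors of `t`-element subsets. -/
theorem single_sub_single_mem_closure_indicators {m t : ℕ} (ht : 1 ≤ t) (htm : t + 1 ≤ m)
    (a b : Fin m) :
    (Pi.single a 1 - Pi.single b 1 : Fin m → ℤ) ∈ AddSubgroup.closure {v : Fin m → ℤ |
        ∃ S : Finset (Fin m), S.card = t ∧ v = fun j => if j ∈ S then 1 else 0} := by
  rcases eq_or_ne a b with rfl | hab
  · simp
  have hcard : t - 1 ≤ (({a, b} : Finset (Fin m))ᶜ).card := by
    rw [card_compl, card_pair hab, Fintype.card_fin]
    omega
  obtain ⟨T, hT, hTcard⟩ := exists_subset_card_eq hcard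
  have ha : a ∉ T := fun h => by simpa using hT h
  have hb : b ∉ T := fun h => by simpa using hT h
  have hmem : ∀ c ∉ T, (fun j => if j ∈ insert c T then 1 else 0 : Fin m → ℤ) ∈
      AddSubgroup.closure {v : Fin m → ℤ |
        ∃ S : Finset (Fin m), S.card = t ∧ v = fun j => if j ∈ S then 1 else 0} := fun c hc =>
    AddSubgroup.subset_closure ⟨insert c T, by rw [card_insert_of_notMem hc]; omega, rfl⟩
  convert sub_mem (hmem a ha) (hmem b hb) using 1
  ext j
  simp only [Pi.sub_apply, Pi.single_apply, mem_insert]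
  grind

/-- For `1 ≤ t ≤ m - 1`, the subgroup of `ℤ^m` generated by the indicator vectors of
all `t`-element subsets of `[m]` is exactly the lattice
`ℒ = {x ∈ ℤ^m : Σ x_i ≡ 0 (mod t)}`. -/
theorem span_indicators_eq_lattice (m t : ℕ) (ht : 1 ≤ t) (htm : t + 1 ≤ m) :
    (AddSubgroup.closure {v : Fin m → ℤ |
        ∃ S : Finset (Fin m), S.card = t ∧ v = fun j => if j ∈ S then 1 else 0} :
      Set (Fin m → ℤ)) = {x : Fin m → ℤ | (t : ℤ) ∣ ∑ i, x i} := by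
  ext x
  simp only [SetLike.mem_coe, Set.mem_ofPred_eq]
  constructor
  · intro hx
    induction hx using AddSubgroup.closure_induction with
    | mem v hv =>
      obtain ⟨S, hS, rfl⟩ := hv
      simp [hS]
    | zero => simp
    | add u v _ _ hu hv => simpa [sum_add_distrib] using dvd_add hu hv
    | neg v _ hv => simpa using hv
  · rintro ⟨k, hk⟩
    have hdiff := single_sub_single_mem_closure_indicators ht htm
    obtain ⟨S, -, hS⟩ := exists_subset_card_eq (s := (univ : Finset (Fin m))) (n := t)
      (by rw [card_univ, Fintype.card_fin]; omega)
    have hind := AddSubgroup.subset_closure (G := Fin m → ℤ) (k := {v : Fin m → ℤ |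
        ∃ S : Finset (Fin m), S.card = t ∧ v = fun j => if j ∈ S then 1 else 0}) ⟨S, hS, rfl⟩
    let a : Fin m := ⟨0, by omega⟩
    have hx : x = ∑ i, x i • (Pi.single i 1 - Pi.single a 1 : Fin m → ℤ) +
        k • ((fun j => if j ∈ S then 1 else 0) -
          ∑ i ∈ S, (Pi.single i 1 - Pi.single a 1 : Fin m → ℤ)) := by
      ext j
      simp only [Pi.add_apply, Finset.sum_apply, Pi.smul_apply, Pi.sub_apply, smul_eq_mul]
      simp only [mul_sub,
        sum_sub_distrib, ← sum_mul, hk, sum_const, hS, nsmul_eq_mul]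
      simp only [Pi.single_apply, mul_ite, mul_one, mul_zero, sum_ite_eq, mem_univ, if_true]
      split_ifs <;> ring
    rw [hx]
    exact add_mem (sum_mem fun i _ => zsmul_mem (hdiff i a) _)
      (zsmul_mem (sub_mem hind (sum_mem fun i _ => hdiff i a)) _)
end

section
/- Let 1 ≤ t ≤ m. For every u ∈ ℤ^m there exists q ∈ ℤ^m with |q_i| ≤ 2 and q_i ≡ u_i (mod 2) for every i, such that w = (u − q)/2 ∈ ℤ^m satisfies Σ_{i=1}^m w_i ≡ 0 (mod t). In particular ‖u − 2w‖_∞ ≤ 2. -/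
open Finset

/-- For `1 ≤ t ≤ m` and any `u ∈ ℤ^m` there is `q ∈ ℤ^m` with `|q_i| ≤ 2`,
`q_i ≡ u_i (mod 2)`, such that `w = (u - q)/2 ∈ ℤ^m` has coordinate sum divisible
by `t`; in particular `‖u - 2w‖_∞ ≤ 2`. -/
theorem rounding_to_lattice (m t : ℕ) (ht : 1 ≤ t) (htm : t ≤ m) (u : Fin m → ℤ) :
    ∃ q w : Fin m → ℤ,
      (∀ i, |q i| ≤ 2 ∧ q i % 2 = u i % 2 ∧ u i = q i + 2 * w i) ∧
      (t : ℤ) ∣ ∑ i, w i ∧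
      (∀ i, |u i - 2 * w i| ≤ 2) := by
  have ht0 : (0 : ℤ) < t := by exact_mod_cast ht
  obtain ⟨r, hr⟩ := Int.eq_ofNat_of_zero_le (Int.emod_nonneg (-∑ i, u i / 2) ht0.ne')
  have hrt : (r : ℤ) < t := hr ▸ Int.emod_lt_of_pos _ ht0
  -- Rounding up the halves on a set of `r` coordinates corrects the sum modulo `t`.
  obtain ⟨s, -, hs⟩ := Finset.exists_subset_card_eq
    (s := (Finset.univ : Finset (Fin m))) (n := r) (by simp; omega)
  have hw : ∀ i, |u i - 2 * (u i / 2 + if i ∈ s then 1 else 0)| ≤ 2 := by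
    intro i
    rw [abs_le]
    split_ifs <;> omega
  refine ⟨fun i => u i - 2 * (u i / 2 + if i ∈ s then 1 else 0),
    fun i => u i / 2 + if i ∈ s then 1 else 0,
    fun i => ⟨hw i, by dsimp only; omega, by ring⟩, ?_, hw⟩
  have hsum : ∑ i, (u i / 2 + if i ∈ s then (1 : ℤ) else 0) = ∑ i, u i / 2 + r := by
    simp [Finset.sum_add_distrib, hs]
  have hdiv := Int.dvd_self_sub_emod (x := -∑ i, u i / 2) (m := (t : ℤ))
  rw [hr] at hdiv
  rw [hsum, ← dvd_neg, neg_add']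
  exact hdiv
end

section
/- There is an absolute constant c > 0 with the following property. Let t ≥ 2 and let (Y, Σ) be a t-sparse set system in which every set S ∈ Σ satisfies |S| ≤ 6t, and let M = {(a_1, b_1), …, (a_k, b_k)} be a partial matching on Y (i.e., a_1, b_1, …, a_k, b_k are 2k distinct elements of Y). Then there exists a coloring χ : Y → {−1, +1} with χ(a_j) = −χ(b_j) for every j ∈ [k] and |χ(S)| ≤ c·√(t·log t) for every S ∈ Σ. -/
open Finset

open Classical in
/-- Symmetric Lovász local lemma for counting on a finite space, conditional form. -/
theorem card_bad_inter_good_le {Ω ι : Type*} [Fintype Ω] (A : ι → Ω → Prop)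
    (Γ : ι → Finset ι) (d : ℕ) (p : ℝ) (hp : 0 ≤ p) (hΓ : ∀ i, #(Γ i) ≤ d) (hpd : 4 * p * d ≤ 1)
    (hA : ∀ i J, Disjoint J (Γ i) →
      (#{ω : Ω | A i ω ∧ ∀ j ∈ J, ¬ A j ω} : ℝ) ≤ p * #{ω : Ω | ∀ j ∈ J, ¬ A j ω})
    (J : Finset ι) (i : ι) :
    (#{ω : Ω | A i ω ∧ ∀ j ∈ J, ¬ A j ω} : ℝ) ≤ 2 * p * #{ω : Ω | ∀ j ∈ J, ¬ A j ω} := by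
  induction J using Finset.strongInduction generalizing i with
  | H J ih =>
  by_cases hJ : Disjoint J (Γ i)
  · refine (hA i J hJ).trans ?_
    have : 0 ≤ p * #{ω : Ω | ∀ j ∈ J, ¬ A j ω} := by positivity
    linarith
  · have hss : J \ Γ i ⊂ J := Finset.sdiff_subset.ssubset_of_ne fun h =>
      hJ (Finset.sdiff_eq_self_iff_disjoint.1 h)
    have h1 : (#{ω : Ω | A i ω ∧ ∀ j ∈ J, ¬ A j ω} : ℝ) ≤
        #{ω : Ω | A i ω ∧ ∀ j ∈ J \ Γ i, ¬ A j ω} := by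
      norm_cast
      refine Finset.card_le_card fun ω => ?_
      simp only [mem_filter, mem_univ, true_and, mem_sdiff]
      exact fun h => ⟨h.1, fun j hj => h.2 j hj.1⟩
    have h2 := hA i (J \ Γ i) Finset.sdiff_disjoint
    have h3 : (#{ω : Ω | ∀ j ∈ J \ Γ i, ¬ A j ω} : ℝ) ≤ #{ω : Ω | ∀ j ∈ J, ¬ A j ω} +
        ∑ j ∈ Γ i, (#{ω : Ω | A j ω ∧ ∀ l ∈ J \ Γ i, ¬ A l ω} : ℝ) := by
      norm_cast
      refine (Finset.card_le_card ?_).trans ((Finset.card_union_le _ _).trans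
        (Nat.add_le_add_left (Finset.card_biUnion_le (s := Γ i)
          (t := fun j => {ω : Ω | A j ω ∧ ∀ l ∈ J \ Γ i, ¬ A l ω})) _))
      intro ω
      simp only [mem_filter, mem_univ, true_and, mem_sdiff, mem_union, mem_biUnion]
      intro h
      by_cases hω : ∀ j ∈ J, ¬ A j ω
      · exact Or.inl hω
      · push Not at hω
        obtain ⟨j, hj, hjA⟩ := hω
        refine Or.inr ⟨j, ?_, hjA, h⟩
        by_contra hjΓ
        exact h j ⟨hj, hjΓ⟩ hjA
    set N : ℝ := ((#{ω : Ω | ∀ j ∈ J \ Γ i, ¬ A j ω} : ℕ) : ℝ) with hN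
    have hN0 : 0 ≤ N := by positivity
    have h4 : ∑ j ∈ Γ i, (#{ω : Ω | A j ω ∧ ∀ l ∈ J \ Γ i, ¬ A l ω} : ℝ) ≤ d * (2 * p * N) := by
      refine (Finset.sum_le_card_nsmul _ _ _ fun j _ => ih _ hss j).trans ?_
      rw [nsmul_eq_mul]
      have : (#(Γ i) : ℝ) ≤ d := by exact_mod_cast hΓ i
      gcongr
    have h5 : N ≤ 2 * #{ω : Ω | ∀ j ∈ J, ¬ A j ω} := by nlinarith
    nlinarith

open Classical in
/-- Symmetric Lovász local lemma for counting on a finite space. -/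
theorem exists_forall_not_of_local {Ω ι : Type*} [Fintype Ω] [Nonempty Ω] [Finite ι]
    (A : ι → Ω → Prop) (Γ : ι → Finset ι) (d : ℕ) (p : ℝ) (hp : 0 ≤ p) (hp2 : 2 * p < 1)
    (hΓ : ∀ i, #(Γ i) ≤ d) (hpd : 4 * p * d ≤ 1)
    (hA : ∀ i J, Disjoint J (Γ i) →
      (#{ω : Ω | A i ω ∧ ∀ j ∈ J, ¬ A j ω} : ℝ) ≤ p * #{ω : Ω | ∀ j ∈ J, ¬ A j ω}) :
    ∃ ω, ∀ i, ¬ A i ω := by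
  have key : ∀ J : Finset ι, ∃ ω, ∀ j ∈ J, ¬ A j ω := by
    intro J
    induction J using Finset.induction_on with
    | empty => simp
    | insert i J _ ih =>
      have h := card_bad_inter_good_le A Γ d p hp hΓ hpd hA J i
      by_contra! h0
      have hle : #{ω : Ω | ∀ j ∈ J, ¬ A j ω} ≤ #{ω : Ω | A i ω ∧ ∀ j ∈ J, ¬ A j ω} := by
        refine Finset.card_le_card fun ω => ?_
        simp only [mem_filter, mem_univ, true_and]
        intro hω
        obtain ⟨j, hj, hjA⟩ := h0 ω
        rcases mem_insert.1 hj with rfl | hj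
        · exact ⟨hjA, hω⟩
        · exact absurd hjA (hω j hj)
      have hle' := (Nat.cast_le (α := ℝ)).2 hle
      have hpos : (0 : ℝ) < #{ω : Ω | ∀ j ∈ J, ¬ A j ω} := by
        obtain ⟨ω, hω⟩ := ih
        exact Nat.cast_pos.2 (Finset.card_pos.2 ⟨ω, mem_filter.2 ⟨mem_univ _, hω⟩⟩)
      exact absurd (hle'.trans h) (not_le.2 ((mul_lt_mul_of_pos_right hp2 hpos).trans_eq
        (one_mul _)))
  cases nonempty_fintype ι
  obtain ⟨ω, hω⟩ := key univ
  exact ⟨ω, fun i => hω i (mem_univ i)⟩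

/-- The exponential moment of a signed sum over a family of sign vectors that is closed under
flipping the coordinates involved. -/
theorem sum_exp_signed_sum {α : Type*} [DecidableEq α] (G : Finset (α → ℤˣ)) (w : α → ℝ)
    (T : Finset α) (hG : ∀ x ∈ T, ∀ σ ∈ G, Function.update σ x (-σ x) ∈ G) :
    ∑ σ ∈ G, Real.exp (∑ x ∈ T, w x * ((σ x : ℤ) : ℝ)) = #G * ∏ x ∈ T, Real.cosh (w x) := by
  induction T using Finset.induction_on with
  | empty => simp
  | insert x T hx ih =>
    have ih' := ih fun y hy => hG y (mem_insert_of_mem hy)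
    have hflip : ∑ σ ∈ G, Real.exp (∑ y ∈ insert x T, w y * ((σ y : ℤ) : ℝ)) =
        ∑ σ ∈ G, Real.exp (-(w x * ((σ x : ℤ) : ℝ)) + ∑ y ∈ T, w y * ((σ y : ℤ) : ℝ)) := by
      refine Finset.sum_nbij' (fun σ => Function.update σ x (-σ x))
        (fun σ => Function.update σ x (-σ x)) (hG x (mem_insert_self x T))
        (hG x (mem_insert_self x T)) (fun σ _ => by simp) (fun σ _ => by simp) fun σ _ => ?_
      rw [Finset.sum_insert hx]
      congr 2
      · simp
      · refine Finset.sum_congr rfl fun y hy => ?_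
        rw [Function.update_of_ne (ne_of_mem_of_not_mem hy hx)]
    have htwo : 2 * ∑ σ ∈ G, Real.exp (∑ y ∈ insert x T, w y * ((σ y : ℤ) : ℝ)) =
        2 * (Real.cosh (w x) * ∑ σ ∈ G, Real.exp (∑ y ∈ T, w y * ((σ y : ℤ) : ℝ))) := by
      rw [two_mul]
      nth_rewrite 2 [hflip]
      rw [← Finset.sum_add_distrib, Finset.mul_sum, Finset.mul_sum]
      refine Finset.sum_congr rfl fun σ _ => ?_
      rw [Finset.sum_insert hx, Real.exp_add, Real.exp_add, Real.cosh_eq]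
      rcases Int.units_eq_one_or (σ x) with h | h <;> simp [h] <;> ring
    rw [mul_left_cancel₀ two_ne_zero htwo, ih', Finset.prod_insert hx]
    ring

/-- Hoeffding's inequality for signed sums over a family of sign vectors that is closed under
flipping the coordinates involved. -/
theorem card_lt_abs_signed_sum_le {α : Type*} [DecidableEq α] (G : Finset (α → ℤˣ)) (w : α → ℝ)
    (T : Finset α) (hG : ∀ x ∈ T, ∀ σ ∈ G, Function.update σ x (-σ x) ∈ G) (V L l : ℝ)
    (hl : 0 ≤ l) (hV : ∑ x ∈ T, w x ^ 2 ≤ V) :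
    (#{σ ∈ G | L < |∑ x ∈ T, w x * ((σ x : ℤ) : ℝ)|} : ℝ) ≤
      2 * Real.exp (l ^ 2 * V / 2 - l * L) * #G := by
  have hmgf : ∀ u : ℝ, u ^ 2 = l ^ 2 →
      ∑ σ ∈ G, Real.exp (∑ x ∈ T, u * w x * ((σ x : ℤ) : ℝ)) ≤
        #G * Real.exp (l ^ 2 * V / 2) := by
    intro u hu
    rw [sum_exp_signed_sum G (fun x => u * w x) T hG]
    gcongr
    calc ∏ x ∈ T, Real.cosh (u * w x) ≤ ∏ x ∈ T, Real.exp ((u * w x) ^ 2 / 2) :=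
          Finset.prod_le_prod (fun x _ => (Real.cosh_pos _).le)
            fun x _ => Real.cosh_le_exp_half_sq _
      _ = Real.exp (l ^ 2 * (∑ x ∈ T, w x ^ 2) / 2) := by
          rw [← Real.exp_sum, Finset.mul_sum, Finset.sum_div]
          simp_rw [mul_pow, hu]
      _ ≤ Real.exp (l ^ 2 * V / 2) := by gcongr
  have hmarkov : (#{σ ∈ G | L < |∑ x ∈ T, w x * ((σ x : ℤ) : ℝ)|} : ℝ) * Real.exp (l * L) ≤
      ∑ σ ∈ G, (Real.exp (∑ x ∈ T, l * w x * ((σ x : ℤ) : ℝ)) +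
        Real.exp (∑ x ∈ T, -l * w x * ((σ x : ℤ) : ℝ))) := by
    rw [← nsmul_eq_mul]
    refine (Finset.card_nsmul_le_sum _ _ _ fun σ hσ => ?_).trans
      (Finset.sum_le_sum_of_subset_of_nonneg (Finset.filter_subset _ G)
        fun σ _ _ => by positivity)
    have hσ' := (mem_filter.1 hσ).2
    simp_rw [mul_assoc]
    rw [← Finset.mul_sum, ← Finset.mul_sum]
    rcases lt_abs.1 hσ' with h | h
    · refine le_add_of_le_of_nonneg (Real.exp_le_exp.2 ?_) (Real.exp_pos _).le
      gcongr
    · refine le_add_of_nonneg_of_le (Real.exp_pos _).le (Real.exp_le_exp.2 ?_)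
      rw [neg_mul, ← mul_neg]
      gcongr
  rw [Finset.sum_add_distrib] at hmarkov
  have h1 := hmgf l rfl
  have h2 := hmgf (-l) (by ring)
  rw [Real.exp_sub]
  have hpos := Real.exp_pos (l * L)
  rw [show 2 * (Real.exp (l ^ 2 * V / 2) / Real.exp (l * L)) * (#G : ℝ) =
    2 * Real.exp (l ^ 2 * V / 2) * #G / Real.exp (l * L) by ring, le_div_iff₀ hpos]
  linarith

/-- A signed sum of pulled-back signs, grouped by the fibres of the map. -/
theorem sum_sign_mul_comp {α : Type*} [DecidableEq α] (S : Finset α) (r : α → α) (s σ : α → ℝ) :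
    ∑ x ∈ S, s x * σ (r x) = ∑ y ∈ S.image r, (∑ x ∈ S with r x = y, s x) * σ y := by
  rw [← Finset.sum_fiberwise_of_maps_to (g := r) (fun x hx => mem_image_of_mem r hx)]
  refine Finset.sum_congr rfl fun y _ => ?_
  rw [Finset.sum_mul]
  exact Finset.sum_congr rfl fun x hx => by rw [(mem_filter.1 hx).2]

/-- If the fibres of `r` have at most two elements, the signed fibre sums over `S` have sum of
squares at most `2 * #S`. -/
theorem sum_sq_fiber_sum_le {α : Type*} [DecidableEq α] (S : Finset α) (r : α → α) (s : α → ℝ)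
    (hs : ∀ x, |s x| ≤ 1) (hr : ∀ y, #{x ∈ S | r x = y} ≤ 2) :
    ∑ y ∈ S.image r, (∑ x ∈ S with r x = y, s x) ^ 2 ≤ 2 * #S := by
  rw [Finset.card_eq_sum_card_fiberwise (f := r) (t := S.image r)
    fun x hx => mem_image_of_mem r hx, Nat.cast_sum, Finset.mul_sum]
  refine Finset.sum_le_sum fun y _ => ?_
  have h1 : |∑ x ∈ S with r x = y, s x| ≤ #{x ∈ S | r x = y} := by
    refine (Finset.abs_sum_le_sum_abs _ _).trans ?_
    simpa using Finset.sum_le_card_nsmul _ _ (1 : ℝ) fun x (_ : x ∈ {x ∈ S | r x = y}) => hs x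
  have h2 : (#{x ∈ S | r x = y} : ℝ) ≤ 2 := by exact_mod_cast hr y
  rw [← sq_abs]
  nlinarith [abs_nonneg (∑ x ∈ S with r x = y, s x)]

/-- In a sparse set system with small sets, few sets meet a given one after identifying points
along a map with fibres of at most two elements. -/
theorem card_filter_not_disjoint_image_le {α ι : Type*} [Fintype α] [DecidableEq α] [Fintype ι]
    (S : ι → Finset α) (r : α → α) (t u : ℕ) (hr : ∀ y, #{x | r x = y} ≤ 2)
    (ht : ∀ x, #{i | x ∈ S i} ≤ t) (hu : ∀ i, #(S i) ≤ u) (i : ι) :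
    #{j | ¬ Disjoint ((S j).image r) ((S i).image r)} ≤ u * (2 * t) := by
  classical
  have hsub : ({j | ¬ Disjoint ((S j).image r) ((S i).image r)} : Finset ι) ⊆
      (S i).biUnion fun x => ({z | r z = r x} : Finset α).biUnion fun z => {j | z ∈ S j} := by
    intro j hj
    obtain ⟨y, hyj, hyi⟩ := Finset.not_disjoint_iff.1 (mem_filter.1 hj).2
    obtain ⟨z, hz, rfl⟩ := mem_image.1 hyj
    obtain ⟨x, hx, hxz⟩ := mem_image.1 hyi
    simp only [mem_biUnion, mem_filter, mem_univ, true_and]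
    exact ⟨x, hx, z, hxz.symm, hz⟩
  refine (Finset.card_le_card hsub).trans ((Finset.card_biUnion_le_card_mul _ _ (2 * t)
    fun x _ => ?_).trans (Nat.mul_le_mul_right _ (hu i)))
  exact (Finset.card_biUnion_le_card_mul _ _ t fun z _ => ht z).trans
    (Nat.mul_le_mul_right _ (hr _))

/-- Low-discrepancy signs exist for a sparse system of small sets when the sign of `x` is
prescribed to be `s x` times the sign of `r x`, for `r` with fibres of at most two elements. -/
theorem exists_signs_abs_sum_le {α ι : Type*} [Fintype α] [DecidableEq α] [Fintype ι] (t : ℕ)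
    (ht2 : 2 ≤ t) (S : ι → Finset α) (ht : ∀ x, #{i | x ∈ S i} ≤ t) (hS : ∀ i, #(S i) ≤ 6 * t)
    (r : α → α) (hr : ∀ y, #{x | r x = y} ≤ 2) (s : α → ℝ) (hs : ∀ x, |s x| ≤ 1) :
    ∃ σ : α → ℤˣ, ∀ i,
      |∑ x ∈ S i, s x * ((σ (r x) : ℤ) : ℝ)| ≤ 15 * Real.sqrt (t * Real.log t) := by
  classical
  have htR : (2 : ℝ) ≤ t := by exact_mod_cast ht2
  have ht0 : (0 : ℝ) < t := by linarith
  have hlog : 0 ≤ Real.log t := Real.log_nonneg (by linarith)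
  have hpow : (128 : ℝ) ≤ t ^ 7 := by
    calc (128 : ℝ) = 2 ^ 7 := by norm_num
      _ ≤ t ^ 7 := by gcongr
  set L := 15 * Real.sqrt (t * Real.log t) with hL
  obtain ⟨σ, hσ⟩ := exists_forall_not_of_local
    (fun (i : ι) (σ : α → ℤˣ) => L < |∑ x ∈ S i, s x * ((σ (r x) : ℤ) : ℝ)|)
    (fun i => {j | ¬ Disjoint ((S j).image r) ((S i).image r)}) (6 * t * (2 * t))
    (2 / t ^ 9) (by positivity)
    (by
      rw [← mul_div_assoc, div_lt_one (by positivity)]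
      nlinarith [mul_le_mul htR htR (by norm_num) ht0.le])
    (fun i => card_filter_not_disjoint_image_le S r t (6 * t) hr ht hS i)
    (by
      push_cast
      rw [show 4 * (2 / (t : ℝ) ^ 9) * (6 * t * (2 * t)) = 96 / t ^ 7 by field_simp; norm_num,
        div_le_one (by positivity)]
      linarith)
    (by
      intro i J hJ
      have h := card_lt_abs_signed_sum_le
        ({σ | ∀ j ∈ J, ¬ L < |∑ x ∈ S j, s x * ((σ (r x) : ℤ) : ℝ)|} : Finset (α → ℤˣ))
        (fun y => ∑ x ∈ S i with r x = y, s x) ((S i).image r) ?_ (12 * t) L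
        (Real.sqrt (Real.log t / t)) (Real.sqrt_nonneg _) ?_
      · have hexp : 2 * Real.exp (Real.sqrt (Real.log t / t) ^ 2 * (12 * t) / 2 -
            Real.sqrt (Real.log t / t) * L) = 2 / (t : ℝ) ^ 9 := by
          have e1 : Real.sqrt (Real.log t / t) * L = 15 * Real.log t := by
            rw [hL, mul_left_comm, ← Real.sqrt_mul (by positivity),
              show Real.log t / t * (t * Real.log t) = Real.log t ^ 2 by field_simp,
              Real.sqrt_sq hlog]
          rw [e1, Real.sq_sqrt (by positivity),
            show Real.log t / t * (12 * t) / 2 - 15 * Real.log t = -((9 : ℕ) * Real.log t) by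
              field_simp; norm_num; ring,
            Real.exp_neg, Real.exp_nat_mul, Real.exp_log ht0, div_eq_mul_inv]
        rw [hexp] at h
        refine le_of_eq_of_le ?_ (h.trans_eq (by congr!))
        rw [Finset.filter_filter]
        congr 2
        ext σ
        simp only [mem_filter, mem_univ, true_and]
        rw [sum_sign_mul_comp (S i) r s fun y => ((σ y : ℤ) : ℝ)]
        exact and_comm
      · intro y hy σ hσ
        simp only [mem_filter, mem_univ, true_and] at hσ ⊢
        intro j hj
        convert hσ j hj using 5 with x hx
        rw [Function.update_of_ne]
        rintro rfl
        have hdis : Disjoint ((S j).image r) ((S i).image r) := by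
          simpa using Finset.disjoint_left.1 hJ hj
        exact Finset.disjoint_left.1 hdis (mem_image_of_mem r hx) hy
      · refine (sum_sq_fiber_sum_le (S i) r s hs fun y => ?_).trans ?_
        · exact (Finset.card_le_card (Finset.filter_subset_filter _ (subset_univ _))).trans (hr y)
        · have : (#(S i) : ℝ) ≤ 6 * t := by exact_mod_cast hS i
          linarith)
  exact ⟨σ, fun i => not_lt.1 (hσ i)⟩

/-- If `(Y, Σ)` is `t`-sparse with all sets of size at most `6t`, and
`M = {(a_1,b_1), …, (a_k,b_k)}` is a partial matching on `Y` (the `2k` elements are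
distinct), then there is a coloring `χ : Y → {±1}` assigning opposite signs to each
pair of `M` such that `|χ(S)| ≤ c √(t log t)` for every `S ∈ Σ`. -/
theorem small_sets_coloring :
    ∃ c : ℝ, 0 < c ∧ ∀ t n m k : ℕ, 2 ≤ t → ∀ S : Fin m → Finset (Fin n),
      (∀ x : Fin n, (Finset.univ.filter fun i : Fin m => x ∈ S i).card ≤ t) →
      (∀ i : Fin m, (S i).card ≤ 6 * t) →
      ∀ a b : Fin k → Fin n,
        Function.Injective (Sum.elim a b : Fin k ⊕ Fin k → Fin n) →
        ∃ χ : Fin n → ℤ, (∀ x, χ x = 1 ∨ χ x = -1) ∧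
          (∀ j : Fin k, χ (a j) = -χ (b j)) ∧
          (∀ i : Fin m, (|∑ x ∈ S i, χ x| : ℝ) ≤ c * Real.sqrt (t * Real.log t)) := by
  classical
  refine ⟨15, by norm_num, fun t n m k ht2 S ht hS a b hab => ?_⟩
  have hb : Function.Injective b := fun i j h => Sum.inr_injective (hab (by simpa using h))
  have hne : ∀ i j, a i ≠ b j := fun i j h =>
    Sum.inl_ne_inr (hab (a₁ := Sum.inl i) (a₂ := Sum.inr j) (by simpa using h))
  have ha : Function.Injective a := fun i j h => Sum.inl_injective (hab (by simpa using h))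
  let r : Fin n → Fin n := fun x => if h : ∃ j, b j = x then a h.choose else x
  let s : Fin n → ℤˣ := fun x => if ∃ j, b j = x then -1 else 1
  have hrb : ∀ j, r (b j) = a j := by
    intro j
    have h : ∃ i, b i = b j := ⟨j, rfl⟩
    simp only [r, dif_pos h]
    exact congrArg a (hb h.choose_spec)
  have hrn : ∀ x, (¬ ∃ j, b j = x) → r x = x := fun x h => dif_neg h
  have hr : ∀ y, #{x | r x = y} ≤ 2 := by
    intro y
    by_cases hy : ∃ j, a j = y
    · obtain ⟨j, rfl⟩ := hy
      refine (Finset.card_le_card (t := {a j, b j}) fun x hx => ?_).trans Finset.card_le_two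
      simp only [mem_filter, mem_univ, true_and] at hx
      by_cases h : ∃ i, b i = x
      · obtain ⟨i, rfl⟩ := h
        rw [hrb] at hx
        simp [ha hx]
      · rw [hrn x h] at hx
        simp [hx]
    · refine (Finset.card_le_card (t := {y}) fun x hx => ?_).trans (by simp)
      simp only [mem_filter, mem_univ, true_and] at hx
      by_cases h : ∃ i, b i = x
      · obtain ⟨i, rfl⟩ := h
        exact absurd ⟨i, (hrb i).symm.trans hx⟩ hy
      · rw [hrn x h] at hx
        simp [hx]
  obtain ⟨σ, hσ⟩ := exists_signs_abs_sum_le t ht2 S ht hS r hr (fun x => ((s x : ℤ) : ℝ))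
    fun x => by rcases Int.units_eq_one_or (s x) with h | h <;> simp [h]
  refine ⟨fun x => ((s x * σ (r x) : ℤˣ) : ℤ), fun x => ?_, fun j => ?_, fun i => ?_⟩
  · rcases Int.units_eq_one_or (s x * σ (r x)) with h | h <;> simp [h]
  · have hna : ¬ ∃ i, b i = a j := fun ⟨i, hi⟩ => hne j i hi.symm
    have hsa : s (a j) = 1 := if_neg hna
    have hsb : s (b j) = -1 := if_pos ⟨j, rfl⟩
    simp [hsa, hsb, hrb, hrn _ hna]
  · simpa using hσ i
end
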